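/- Let α > 1 be a real number and let P be an infinite hereditary property of graphs. Then λ^(α)(P) = π(P); that is, lim_{n→∞} λ^(α)(P,n)·n^{(2/α)−2} = lim_{n→∞} ex(P,n)/C(n,2). -/

import Mathlib

open Filter

/-- A family of finite simple graphs, given by the set of its members of each order `n`
(a member of order `n` is a graph on the vertex set `Fin n`). -/
abbrev GraphFamily := ∀ n : ℕ, Set (SimpleGraph (Fin n))

/-- A family of graphs is hereditary if it is closed under taking induced subgraphs. -/
def IsHereditary (P : GraphFamily) : Prop :=
  ∀ ⦃m n : ℕ⦄ (f : Fin m ↪ Fin n) ⦃G : SimpleGraph (Fin n)⦄,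
    G ∈ P n → G.comap f ∈ P m

/-- The number of edges of a graph. -/
noncomputable def edgeCount {n : ℕ} (G : SimpleGraph (Fin n)) : ℕ :=
  G.edgeSet.ncard

/-- `exP P n` is the maximum number of edges of a graph of order `n` belonging to `P`. -/
noncomputable def exP (P : GraphFamily) (n : ℕ) : ℕ :=
  sSup {m | ∃ G ∈ P n, edgeCount G = m}

open Classical in
/-- `quadSum G x = 2 * ∑_{{u,v} ∈ E(G)} x_u * x_v`. -/
noncomputable def quadSum {n : ℕ} (G : SimpleGraph (Fin n)) (x : Fin n → ℝ) : ℝ :=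
  ∑ u, ∑ v, if G.Adj u v then x u * x v else 0

/-- `λ^(α)(G)`: the maximum of `2∑_{{u,v}∈E(G)} x_u x_v` over real vectors `x`
with `∑ |x_i|^α = 1`. -/
noncomputable def lambdaA (α : ℝ) {n : ℕ} (G : SimpleGraph (Fin n)) : ℝ :=
  sSup {y | ∃ x : Fin n → ℝ, (∑ i, |x i| ^ α) = 1 ∧ y = quadSum G x}

/-- `λ^(α)(P, n)`: the maximum of `λ^(α)(G)` over graphs `G` of order `n` in `P`. -/
noncomputable def lambdaP (α : ℝ) (P : GraphFamily) (n : ℕ) : ℝ :=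
  sSup {y | ∃ G ∈ P n, y = lambdaA α G}

/-- `H` is isomorphic to an induced subgraph of `G`. -/
def IsInducedSubgraph {V W : Type*} (H : SimpleGraph V) (G : SimpleGraph W) : Prop :=
  ∃ f : V ↪ W, ∀ u v, G.Adj (f u) (f v) ↔ H.Adj u v

/-- `H` is isomorphic to a (not necessarily induced) subgraph of `G`. -/
def IsSubgraphOf {V W : Type*} (H : SimpleGraph V) (G : SimpleGraph W) : Prop :=
  ∃ f : V ↪ W, ∀ u v, H.Adj u v → G.Adj (f u) (f v)

/-- `Her F`: the family of all graphs containing no member of `F` (of order ≥ 1)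
as an induced subgraph. -/
def Her (F : GraphFamily) : GraphFamily :=
  fun _ => {G | ∀ m, 1 ≤ m → ∀ H ∈ F m, ¬ IsInducedSubgraph H G}

/-- A family of graphs is infinite iff it contains graphs of infinitely many orders
(each order carries only finitely many graphs). -/
def FamInfinite (P : GraphFamily) : Prop := {n | (P n).Nonempty}.Infinite

/-- `G` is a complete `r`-partite graph: its vertex set splits into `r` nonempty
independent parts, with all edges present between distinct parts. -/
def IsCompletePartite (r : ℕ) {n : ℕ} (G : SimpleGraph (Fin n)) : Prop :=
  ∃ c : Fin n → Fin r, Function.Surjective c ∧ ∀ u v, G.Adj u v ↔ c u ≠ c v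

/-- `ω̲(F)`: the least `r ≥ 1` with `K_r ∈ F`, or `0` (`= sInf ∅`) if `F` contains
no complete graph. -/
noncomputable def omegaLow (F : GraphFamily) : ℕ :=
  sInf {r | 1 ≤ r ∧ (⊤ : SimpleGraph (Fin r)) ∈ F r}

/-- `β(F)`: the least `r ≥ 1` such that `F` contains a complete `r`-partite graph,
or `0` (`= sInf ∅`) if `F` contains no complete multipartite graph. -/
noncomputable def betaF (F : GraphFamily) : ℕ :=
  sInf {r | 1 ≤ r ∧ ∃ n, ∃ G ∈ F n, IsCompletePartite r G}

theorem sum_prod_mul_apply_two {ι κ : Type*} [Fintype ι] [DecidableEq ι] [Fintype κ]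
    [DecidableEq κ] (x : κ → ℝ) {i j : ι} (hij : i ≠ j) (g : κ → κ → ℝ) :
    ∑ f : ι → κ, (∏ k, x (f k)) * g (f i) (f j) =
      (∑ u, x u) ^ (Fintype.card ι - 2) * ∑ u, ∑ v, x u * x v * g u v := by
  have key (u v : κ) : ∑ f : ι → κ, (∏ k, x (f k)) *
      ((if f i = u then 1 else 0) * (if f j = v then 1 else 0)) =
      (∑ w, x w) ^ (Fintype.card ι - 2) * (x u * x v) := by
    let h : ι → κ → ℝ := fun k w => x w *
      ((if k = i then (if w = u then 1 else 0) else 1) *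
        (if k = j then (if w = v then 1 else 0) else 1))
    have h₁ (f : ι → κ) : (∏ k, x (f k)) *
        ((if f i = u then 1 else 0) * (if f j = v then 1 else 0)) = ∏ k, h k (f k) := by
      simp only [h, Finset.prod_mul_distrib]
      rw [Finset.prod_ite_eq_of_mem' _ _ _ (Finset.mem_univ _),
        Finset.prod_ite_eq_of_mem' _ _ _ (Finset.mem_univ _)]
    simp_rw [h₁]
    rw [← Fintype.piFinset_univ, ← Finset.prod_univ_sum]
    have hj : j ∈ Finset.univ.erase i := by simp [hij.symm]
    rw [← Finset.mul_prod_erase _ _ (Finset.mem_univ i), ← Finset.mul_prod_erase _ _ hj]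
    have h₂ : ∑ w, h i w = x u := by simp [h, hij]
    have h₃ : ∑ w, h j w = x v := by simp [h, hij.symm]
    have h₄ : ∏ k ∈ (Finset.univ.erase i).erase j, ∑ w, h k w =
        (∑ w, x w) ^ (Fintype.card ι - 2) := by
      rw [Finset.prod_congr rfl (g := fun _ => ∑ w, x w), Finset.prod_const,
        Finset.card_erase_of_mem hj, Finset.card_erase_of_mem (Finset.mem_univ i),
        Finset.card_univ, Nat.sub_sub]
      intro k hk
      simp only [Finset.mem_erase] at hk
      simp [h, hk.1, hk.2.1]
    rw [h₂, h₃, h₄]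
    ring
  have hg (f : ι → κ) : g (f i) (f j) =
      ∑ u, ∑ v, g u v * ((if f i = u then 1 else 0) * (if f j = v then 1 else 0)) := by
    simp only [mul_ite, mul_one, mul_zero, Finset.sum_ite_eq, Finset.mem_univ, if_true]
  calc _ = ∑ u, ∑ v, g u v * ∑ f : ι → κ, (∏ k, x (f k)) *
        ((if f i = u then 1 else 0) * (if f j = v then 1 else 0)) := by
        simp_rw [hg, Finset.mul_sum]
        rw [Finset.sum_comm]
        refine Finset.sum_congr rfl fun u _ => ?_
        rw [Finset.sum_comm]
        refine Finset.sum_congr rfl fun v _ => Finset.sum_congr rfl fun f _ => ?_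
        ring
    _ = _ := by
        simp_rw [key, Finset.mul_sum]
        refine Finset.sum_congr rfl fun u _ => Finset.sum_congr rfl fun v _ => ?_
        ring

theorem IsHereditary.nonempty {P : GraphFamily} (hP : IsHereditary P) (hinf : FamInfinite P)
    (n : ℕ) : (P n).Nonempty := by
  obtain ⟨m, ⟨G, hG⟩, hm⟩ := hinf.exists_gt n
  exact ⟨_, hP (Fin.castLEEmb hm.le) hG⟩

theorem edgeCount_le_exP {P : GraphFamily} {n : ℕ} {G : SimpleGraph (Fin n)} (hG : G ∈ P n) :
    edgeCount G ≤ exP P n :=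
  le_csSup ((Set.toFinite (P n)).image edgeCount).bddAbove ⟨G, hG, rfl⟩

theorem exists_edgeCount_eq_exP {P : GraphFamily} {n : ℕ} (h : (P n).Nonempty) :
    ∃ G ∈ P n, edgeCount G = exP P n :=
  Nat.sSup_mem (s := {m | ∃ G ∈ P n, edgeCount G = m}) (h.image edgeCount)
    ((Set.toFinite (P n)).image edgeCount).bddAbove

theorem edgeCount_le_choose {n : ℕ} (G : SimpleGraph (Fin n)) : edgeCount G ≤ n.choose 2 := by
  classical
  have := G.card_edgeFinset_le_card_choose_two
  rwa [Fintype.card_fin, ← Set.ncard_coe_finset, SimpleGraph.coe_edgeFinset] at this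

theorem quadSum_const {n : ℕ} (G : SimpleGraph (Fin n)) (c : ℝ) :
    quadSum G (fun _ => c) = 2 * edgeCount G * c ^ 2 := by
  classical
  have h := G.sum_degrees_eq_twice_card_edges
  rw [← Set.ncard_coe_finset, SimpleGraph.coe_edgeFinset] at h
  have h' : (∑ u, (G.degree u : ℝ)) = 2 * edgeCount G := by
    unfold edgeCount
    exact_mod_cast h
  have hu (u : Fin n) : (∑ v, if G.Adj u v then c * c else 0) = G.degree u * c ^ 2 := by
    rw [← Finset.sum_filter, Finset.sum_const, nsmul_eq_mul, ← SimpleGraph.neighborFinset_eq_filter,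
      SimpleGraph.card_neighborFinset_eq_degree, sq]
  have hq : quadSum G (fun _ => c) = ∑ u, ∑ v, if G.Adj u v then c * c else 0 := by
    unfold quadSum
    congr! 2
  rw [hq, Finset.sum_congr rfl fun u _ => hu u, ← Finset.sum_mul, h']

theorem quadSum_le_quadSum_abs {n : ℕ} (G : SimpleGraph (Fin n)) (x : Fin n → ℝ) :
    quadSum G x ≤ quadSum G (fun i => |x i|) := by
  unfold quadSum
  gcongr with u _ v _
  split_ifs
  · rw [← abs_mul]
    exact le_abs_self _
  · rfl

open Classical in
/-- An upper bound for the number of ordered adjacent pairs in a sample `f` of `m` vertices,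
taken with repetitions, of a graph with a hereditary property. -/
theorem IsHereditary.sum_offDiag_adj_le {P : GraphFamily} (hP : IsHereditary P) {m n : ℕ}
    {G : SimpleGraph (Fin n)} (hG : G ∈ P n) (f : Fin m → Fin n) :
    ∑ p ∈ (Finset.univ : Finset (Fin m)).offDiag, (if G.Adj (f p.1) (f p.2) then (1 : ℝ) else 0) ≤
      2 * exP P m + (m : ℝ) ^ 2 *
        ∑ p ∈ (Finset.univ : Finset (Fin m)).offDiag, (if f p.1 = f p.2 then (1 : ℝ) else 0) := by
  have hnn : 0 ≤ ∑ p ∈ (Finset.univ : Finset (Fin m)).offDiag,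
      (if f p.1 = f p.2 then (1 : ℝ) else 0) :=
    Finset.sum_nonneg fun p _ => by split_ifs <;> norm_num
  by_cases hf : Function.Injective f
  · have h₁ : ∑ p ∈ (Finset.univ : Finset (Fin m)).offDiag,
        (if G.Adj (f p.1) (f p.2) then (1 : ℝ) else 0) ≤
        quadSum (G.comap (⟨f, hf⟩ : Fin m ↪ Fin n)) (fun _ => 1) := by
      unfold quadSum
      refine le_of_le_of_eq ?_ (Fintype.sum_prod_type' _)
      refine le_trans (Finset.sum_le_sum fun p _ => ?_) (Finset.sum_le_sum_of_subset_of_nonneg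
        (Finset.subset_univ _) fun p _ _ => by split_ifs <;> norm_num)
      simp
    rw [quadSum_const] at h₁
    have h₂ : (edgeCount (G.comap (⟨f, hf⟩ : Fin m ↪ Fin n)) : ℝ) ≤ exP P m := by
      exact_mod_cast edgeCount_le_exP (hP ⟨f, hf⟩ hG)
    have : 0 ≤ (m : ℝ) ^ 2 * ∑ p ∈ (Finset.univ : Finset (Fin m)).offDiag,
      (if f p.1 = f p.2 then (1 : ℝ) else 0) := by positivity
    linarith
  · obtain ⟨i, j, hfij, hij⟩ : ∃ i j, f i = f j ∧ i ≠ j := by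
      simpa [Function.Injective] using hf
    have h₁ : (1 : ℝ) ≤ ∑ p ∈ (Finset.univ : Finset (Fin m)).offDiag,
        (if f p.1 = f p.2 then (1 : ℝ) else 0) := by
      have := Finset.single_le_sum (s := (Finset.univ : Finset (Fin m)).offDiag)
        (f := fun p => if f p.1 = f p.2 then (1 : ℝ) else 0)
        (fun p _ => by split_ifs <;> norm_num) (a := (i, j)) (by simp [hij])
      simpa [hfij] using this
    have h₂ : ∑ p ∈ (Finset.univ : Finset (Fin m)).offDiag,
        (if G.Adj (f p.1) (f p.2) then (1 : ℝ) else 0) ≤ (m : ℝ) ^ 2 := by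
      calc _ ≤ ∑ p ∈ (Finset.univ : Finset (Fin m)).offDiag, (1 : ℝ) := by
            gcongr with p
            split_ifs <;> norm_num
        _ ≤ ∑ p : Fin m × Fin m, (1 : ℝ) :=
            Finset.sum_le_sum_of_subset_of_nonneg (Finset.subset_univ _)
              fun _ _ _ => zero_le_one
        _ = (m : ℝ) ^ 2 := by simp [sq]
    have : (m : ℝ) ^ 2 * 1 ≤ (m : ℝ) ^ 2 * ∑ p ∈ (Finset.univ : Finset (Fin m)).offDiag,
      (if f p.1 = f p.2 then (1 : ℝ) else 0) := by gcongr
    have : (0 : ℝ) ≤ exP P m := by positivity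
    linarith

/-- Sampling `m` vertices independently with probabilities proportional to `x` compares the
quadratic form of `G` at `x` with the edge density of graphs of order `m`. -/
theorem IsHereditary.quadSum_le {P : GraphFamily} (hP : IsHereditary P) {m n : ℕ} (hm : 2 ≤ m)
    {G : SimpleGraph (Fin n)} (hG : G ∈ P n) {x : Fin n → ℝ} (hx : ∀ i, 0 ≤ x i)
    (hS : 0 < ∑ i, x i) :
    quadSum G x ≤ exP P m / m.choose 2 * (∑ i, x i) ^ 2 + (m : ℝ) ^ 2 * ∑ i, x i ^ 2 := by
  classical
  set S := ∑ i, x i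
  set D := (Finset.univ : Finset (Fin m)).offDiag
  have hD : (D.card : ℝ) = m * (m - 1) := by
    rw [Finset.offDiag_card, Nat.cast_sub (Nat.le_mul_self _)]
    simp
    ring
  have hsum (g : Fin n → Fin n → ℝ) :
      ∑ f : Fin m → Fin n, (∏ k, x (f k)) * ∑ p ∈ D, g (f p.1) (f p.2) =
        m * (m - 1) * (S ^ (m - 2) * ∑ u, ∑ v, x u * x v * g u v) := by
    simp_rw [Finset.mul_sum (s := D)]
    rw [Finset.sum_comm, Finset.sum_congr rfl fun p hp =>
      sum_prod_mul_apply_two x (Finset.mem_offDiag.1 hp).2.2 g, Finset.sum_const, nsmul_eq_mul, hD,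
      Fintype.card_fin]
  have hall : ∑ f : Fin m → Fin n, ∏ k, x (f k) = S ^ m := by
    rw [← Fintype.piFinset_univ, ← Finset.prod_univ_sum]
    simp [S]
  have hq : ∑ u, ∑ v, x u * x v * (if G.Adj u v then 1 else 0) = quadSum G x := by
    unfold quadSum
    refine Finset.sum_congr rfl fun u _ => Finset.sum_congr rfl fun v _ => ?_
    split_ifs <;> simp
  have hd : ∑ u, ∑ v, x u * x v * (if u = v then 1 else 0) = ∑ u, x u ^ 2 := by
    simp [sq]
  have h : m * (m - 1) * (S ^ (m - 2) * quadSum G x) ≤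
      2 * exP P m * S ^ m + (m : ℝ) ^ 2 * (m * (m - 1) * (S ^ (m - 2) * ∑ u, x u ^ 2)) := by
    rw [← hq, ← hd, ← hsum, ← hsum, ← hall, Finset.mul_sum, Finset.mul_sum,
      ← Finset.sum_add_distrib]
    refine Finset.sum_le_sum fun f _ => ?_
    have := mul_le_mul_of_nonneg_left (hP.sum_offDiag_adj_le hG f)
      (Finset.prod_nonneg fun k (_ : k ∈ Finset.univ) => hx (f k))
    linarith
  have hm' : (2 : ℝ) ≤ m := by exact_mod_cast hm
  have hm₁ : (0 : ℝ) < m - 1 := by linarith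
  have hpow : S ^ m = S ^ (m - 2) * S ^ 2 := by rw [← pow_add, Nat.sub_add_cancel hm]
  have hpos : 0 < m * (m - 1) * S ^ (m - 2) := by positivity
  refine le_of_mul_le_mul_left (h.trans_eq' (by ring) |>.trans_eq ?_) hpos
  rw [hpow, Nat.cast_choose_two]
  field_simp

theorem IsHereditary.quadSum_le_of_sum_rpow_eq_one {P : GraphFamily} (hP : IsHereditary P)
    {α : ℝ} (hα : 1 < α) {m n : ℕ} (hm : 2 ≤ m)
    {G : SimpleGraph (Fin n)} (hG : G ∈ P n) {x : Fin n → ℝ} (hx : ∑ i, |x i| ^ α = 1) :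
    quadSum G x ≤ exP P m / m.choose 2 * ((n : ℝ) ^ (1 - 1 / α)) ^ 2 +
      (m : ℝ) ^ 2 * (n : ℝ) ^ (1 - 1 / α) := by
  have hα0 : 0 < α := by linarith
  have hle (i) : |x i| ≤ 1 := by
    have : |x i| ^ α ≤ 1 := hx ▸ Finset.single_le_sum (f := fun i => |x i| ^ α)
      (fun j _ => by positivity) (Finset.mem_univ i)
    by_contra! h
    exact absurd this (not_le.2 (Real.one_lt_rpow h hα0))
  have hS : 0 < ∑ i, |x i| := by
    refine (Finset.sum_nonneg fun i _ => abs_nonneg _).lt_of_ne' fun h => ?_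
    rw [Finset.sum_eq_zero_iff_of_nonneg fun i _ => abs_nonneg _] at h
    rw [Finset.sum_eq_zero fun i hi => by rw [h i hi, Real.zero_rpow hα0.ne']] at hx
    exact zero_ne_one hx
  have hN : ∑ i, |x i| ≤ (n : ℝ) ^ (1 - 1 / α) := by
    have h := Real.rpow_sum_le_const_mul_sum_rpow Finset.univ x hα.le
    rw [hx, mul_one, Finset.card_univ, Fintype.card_fin] at h
    rw [← Real.le_rpow_inv_iff_of_pos hS.le (by positivity) hα0, ← Real.rpow_mul (by positivity)] at h
    convert h using 2
    field_simp
  have hsq : ∑ i, |x i| ^ 2 ≤ ∑ i, |x i| :=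
    Finset.sum_le_sum fun i _ => by nlinarith [hle i, abs_nonneg (x i)]
  calc quadSum G x ≤ quadSum G (fun i => |x i|) := quadSum_le_quadSum_abs G x
    _ ≤ _ := hP.quadSum_le hm hG (fun i => abs_nonneg (x i)) hS
    _ ≤ _ := by
      gcongr
      exact hsq.trans hN

theorem exP_div_choose_le_one {P : GraphFamily} {n : ℕ} (h : (P n).Nonempty) :
    (exP P n : ℝ) / n.choose 2 ≤ 1 := by
  obtain ⟨G, -, hG⟩ := exists_edgeCount_eq_exP h
  rw [← hG]
  exact div_le_one_of_le₀ (by exact_mod_cast edgeCount_le_choose G) (by positivity)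

theorem rpow_mul_sq_rpow {n : ℕ} (hn : 0 < n) (α : ℝ) :
    ((n : ℝ) ^ (1 - 1 / α)) ^ 2 * (n : ℝ) ^ (2 / α - 2) = 1 := by
  have : (0 : ℝ) < n := by exact_mod_cast hn
  rw [← Real.rpow_mul_natCast this.le, ← Real.rpow_add this,
    show (1 - 1 / α) * (2 : ℕ) + (2 / α - 2) = 0 by push_cast; ring, Real.rpow_zero]

section lambdaBounds

variable {P : GraphFamily} {α : ℝ} {n : ℕ}

theorem sum_abs_const_rpow (hα : α ≠ 0) (hn : 0 < n) :
    ∑ _i : Fin n, |(n : ℝ) ^ (-1 / α)| ^ α = 1 := by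
  have hn' : (0 : ℝ) < n := by exact_mod_cast hn
  rw [Finset.sum_const, Finset.card_univ, Fintype.card_fin, abs_of_pos (by positivity),
    ← Real.rpow_mul hn'.le, div_mul_cancel₀ _ hα, Real.rpow_neg_one, nsmul_eq_mul,
    mul_inv_cancel₀ hn'.ne']

theorem IsHereditary.lambdaA_le (hP : IsHereditary P) (hα : 1 < α) (hn : 0 < n) {m : ℕ}
    (hm : 2 ≤ m) {G : SimpleGraph (Fin n)} (hG : G ∈ P n) :
    lambdaA α G ≤ exP P m / m.choose 2 * ((n : ℝ) ^ (1 - 1 / α)) ^ 2 +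
      (m : ℝ) ^ 2 * (n : ℝ) ^ (1 - 1 / α) := by
  refine csSup_le ⟨_, _, sum_abs_const_rpow (by linarith) hn, rfl⟩ ?_
  rintro _ ⟨x, hx, rfl⟩
  exact hP.quadSum_le_of_sum_rpow_eq_one hα hm hG hx

theorem IsHereditary.lambdaP_mul_rpow_le (hP : IsHereditary P) (hne : (P n).Nonempty)
    (hα : 1 < α) (hn : 0 < n) {m : ℕ} (hm : 2 ≤ m) :
    lambdaP α P n * (n : ℝ) ^ (2 / α - 2) ≤
      exP P m / m.choose 2 + (m : ℝ) ^ 2 * (n : ℝ) ^ (-(1 - 1 / α)) := by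
  have hn' : (0 : ℝ) < n := by exact_mod_cast hn
  have h : lambdaP α P n ≤ exP P m / m.choose 2 * ((n : ℝ) ^ (1 - 1 / α)) ^ 2 +
      (m : ℝ) ^ 2 * (n : ℝ) ^ (1 - 1 / α) := by
    obtain ⟨G, hG⟩ := hne
    refine csSup_le ⟨_, G, hG, rfl⟩ ?_
    rintro _ ⟨G, hG, rfl⟩
    exact hP.lambdaA_le hα hn hm hG
  have h₂ : (n : ℝ) ^ (1 - 1 / α) * (n : ℝ) ^ (2 / α - 2) = (n : ℝ) ^ (-(1 - 1 / α)) := by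
    rw [← Real.rpow_add hn']
    ring_nf
  calc _ ≤ _ := mul_le_mul_of_nonneg_right h (by positivity)
    _ = _ := by rw [add_mul, mul_assoc, rpow_mul_sq_rpow hn, mul_assoc, h₂, mul_one]

theorem IsHereditary.le_lambdaP_mul_rpow (hP : IsHereditary P) (hne : (P n).Nonempty)
    (hα : 1 < α) (hn : 2 ≤ n) :
    (exP P n : ℝ) / n.choose 2 - 1 / n ≤ lambdaP α P n * (n : ℝ) ^ (2 / α - 2) := by
  have hn0 : 0 < n := by omega
  have hn' : (2 : ℝ) ≤ n := by exact_mod_cast hn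
  obtain ⟨G, hG, hGe⟩ := exists_edgeCount_eq_exP hne
  have h₁ : 2 * exP P n * ((n : ℝ) ^ (-1 / α)) ^ 2 ≤ lambdaA α G := by
    rw [← hGe, ← quadSum_const]
    refine le_csSup ⟨exP P 2 / (2 : ℕ).choose 2 * ((n : ℝ) ^ (1 - 1 / α)) ^ 2 +
      ((2 : ℕ) : ℝ) ^ 2 * (n : ℝ) ^ (1 - 1 / α), ?_⟩ ⟨_, sum_abs_const_rpow (by linarith) hn0, rfl⟩
    rintro _ ⟨x, hx, rfl⟩
    exact hP.quadSum_le_of_sum_rpow_eq_one hα le_rfl hG hx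
  have h₂ : lambdaA α G ≤ lambdaP α P n := by
    refine le_csSup ⟨exP P 2 / (2 : ℕ).choose 2 * ((n : ℝ) ^ (1 - 1 / α)) ^ 2 +
      ((2 : ℕ) : ℝ) ^ 2 * (n : ℝ) ^ (1 - 1 / α), ?_⟩ ⟨G, hG, rfl⟩
    rintro _ ⟨G, hG, rfl⟩
    exact hP.lambdaA_le hα hn0 le_rfl hG
  have h₃ : ((n : ℝ) ^ (-1 / α)) ^ 2 * (n : ℝ) ^ (2 / α - 2) = 1 / (n : ℝ) ^ 2 := by
    rw [← Real.rpow_mul_natCast (by positivity), ← Real.rpow_add (by positivity),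
      show -1 / α * (2 : ℕ) + (2 / α - 2) = -(2 : ℕ) by push_cast; ring,
      Real.rpow_neg (by positivity), Real.rpow_natCast, one_div]
  have h₄ := exP_div_choose_le_one hne
  calc (exP P n : ℝ) / n.choose 2 - 1 / n
      ≤ exP P n / n.choose 2 - exP P n / n.choose 2 * (1 / n) := by
        gcongr
        exact mul_le_of_le_one_left (by positivity) h₄
    _ = 2 * exP P n * ((n : ℝ) ^ (-1 / α)) ^ 2 * (n : ℝ) ^ (2 / α - 2) := by
        rw [mul_assoc, h₃, Nat.cast_choose_two]
        have : (n : ℝ) - 1 ≠ 0 := by linarith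
        field_simp
    _ ≤ _ := mul_le_mul_of_nonneg_right (h₁.trans h₂) (by positivity)

end lambdaBounds

/-- For `α > 1` and an infinite hereditary property `P` of graphs,
`λ^(α)(P) = π(P)`: the limits `lim_{n→∞} λ^(α)(P,n) ⬝ n^{2/α−2}` and
`lim_{n→∞} ex(P,n)/C(n,2)` exist and are equal. -/
theorem lambdaP_lim_eq_pi (α : ℝ) (hα : 1 < α) (P : GraphFamily) (hP : IsHereditary P)
    (hinf : FamInfinite P) :
    ∃ c : ℝ,
      Tendsto (fun n : ℕ => lambdaP α P n * (n : ℝ) ^ (2 / α - 2)) atTop (nhds c) ∧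
      Tendsto (fun n : ℕ => (exP P n : ℝ) / (n.choose 2 : ℝ)) atTop (nhds c) := by
  have hα0 : 0 < 1 - 1 / α := sub_pos.2 ((div_lt_one (by linarith)).2 hα)
  set a : ℕ → ℝ := fun n => (exP P n : ℝ) / (n.choose 2 : ℝ)
  set b : ℕ → ℝ := fun n => lambdaP α P n * (n : ℝ) ^ (2 / α - 2)
  have hne := hP.nonempty hinf
  have hbdd : BddBelow (a '' Set.Ici 2) :=
    ⟨0, by rintro _ ⟨m, -, rfl⟩; positivity⟩
  set c := sInf (a '' Set.Ici 2)
  have hca {m : ℕ} (hm : 2 ≤ m) : c ≤ a m := csInf_le hbdd ⟨m, hm, rfl⟩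
  have hinv : Tendsto (fun n : ℕ => 1 / (n : ℝ)) atTop (nhds 0) :=
    tendsto_one_div_atTop_nhds_zero_nat
  have hpow : Tendsto (fun n : ℕ => (n : ℝ) ^ (-(1 - 1 / α))) atTop (nhds 0) :=
    (tendsto_rpow_neg_atTop hα0).comp tendsto_natCast_atTop_atTop
  have hb : Tendsto b atTop (nhds c) := by
    refine tendsto_order.2 ⟨fun l hl => ?_, fun u hu => ?_⟩
    · have h : Tendsto (fun n : ℕ => c - 1 / (n : ℝ)) atTop (nhds c) := by
        simpa using hinv.const_sub c
      filter_upwards [h.eventually_const_lt hl, eventually_ge_atTop 2] with n h₁ h₂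
      have := hP.le_lambdaP_mul_rpow (hne n) hα h₂
      linarith [hca h₂]
    · obtain ⟨_, ⟨m, hm, rfl⟩, hmu⟩ := exists_lt_of_csInf_lt
        (Set.nonempty_Ici.image a) hu
      have h : Tendsto (fun n : ℕ => a m + (m : ℝ) ^ 2 * (n : ℝ) ^ (-(1 - 1 / α))) atTop
          (nhds (a m)) := by
        simpa using (hpow.const_mul ((m : ℝ) ^ 2)).const_add (a m)
      filter_upwards [h.eventually_lt_const hmu, eventually_ge_atTop 2] with n h₁ h₂
      exact (hP.lambdaP_mul_rpow_le (hne n) hα (by omega) hm).trans_lt h₁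
  refine ⟨c, hb, ?_⟩
  have hupper : Tendsto (fun n : ℕ => b n + 1 / (n : ℝ)) atTop (nhds c) := by
    simpa using hb.add hinv
  refine tendsto_of_tendsto_of_tendsto_of_le_of_le' tendsto_const_nhds hupper ?_ ?_
  · filter_upwards [eventually_ge_atTop 2] with n hn using hca hn
  · filter_upwards [eventually_ge_atTop 2] with n hn
    have := hP.le_lambdaP_mul_rpow (hne n) hα hn
    linarith
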